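/- Let σ > 0, τ, λ, η ∈ ℝ, α > 0, j ∈ ℤ with j ≠ 0, l ≥ 1, and let β ∈ ℂ satisfy f_{jl}(β) = 0, β ≠ −γ_{jl}², and β ≠ −τγ_{jl}². Define complex-valued functions on ℝ² by u(x,z) = (ilπ/(jα)) e^{ijαx} cos(lπz), w(x,z) = e^{ijαx} sin(lπz), T(x,z) = (β + γ_{jl}²)⁻¹ e^{ijαx} sin(lπz), S(x,z) = (β + τγ_{jl}²)⁻¹ e^{ijαx} sin(lπz), and p(x,z) = −(lπ(β + σγ_{jl}²)/(σ j²α²)) e^{ijαx} cos(lπz). Then the eigenvalue equations hold pointwise: σ(Δu − ∂ₓp) = βu; σ(Δw − ∂_z p) + σλT − σηS = βw; ΔT + w = βT; τΔS + w = βS; ∂ₓu + ∂_z w = 0; and the boundary conditions ∂_z u = w = T = S = 0 hold at z = 0 and z = 1. -/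

import Mathlib

open Real

/-- γ_{jl}² = j²α² + l²π². -/
noncomputable def gamma2 (α : ℝ) (j : ℤ) (l : ℕ) : ℝ :=
  (j : ℝ)^2 * α^2 + (l : ℝ)^2 * π^2

/-- The cubic polynomial f_{jl}(β) evaluated at complex arguments via its real
coefficients. -/
noncomputable def fjlC (σ τ lam η α : ℝ) (j : ℤ) (l : ℕ) (β : ℂ) : ℂ :=
  β^3 + (((σ + τ + 1) * gamma2 α j l : ℝ) : ℂ) * β^2
    + ((((σ + τ + σ*τ) * (gamma2 α j l)^2
        - σ * (j : ℝ)^2 * α^2 * (gamma2 α j l)⁻¹ * (lam - η)) : ℝ) : ℂ) * β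
    + (((σ * τ * (gamma2 α j l)^3 + σ * (j : ℝ)^2 * α^2 * (η - τ * lam)) : ℝ) : ℂ)

/-- ∂/∂x of a complex-valued function of (x, z). -/
noncomputable def pdx (f : ℝ → ℝ → ℂ) (x z : ℝ) : ℂ :=
  deriv (fun t => f t z) x

/-- ∂/∂z of a complex-valued function of (x, z). -/
noncomputable def pdz (f : ℝ → ℝ → ℂ) (x z : ℝ) : ℂ :=
  deriv (fun t => f x t) z

/-- The Laplacian Δ = ∂ₓₓ + ∂_zz of a complex-valued function of (x, z). -/
noncomputable def lap (f : ℝ → ℝ → ℂ) (x z : ℝ) : ℂ :=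
  pdx (pdx f) x z + pdz (pdz f) x z

theorem hasDerivAt_cexp_ofReal (k : ℂ) (x : ℝ) :
    HasDerivAt (fun t : ℝ => Complex.exp (k * (t : ℂ))) (k * Complex.exp (k * (x : ℂ))) x := by
  have h := (((hasDerivAt_id (x : ℂ)).const_mul k).cexp).comp_ofReal
  simpa [mul_comm] using h

theorem hasDerivAt_ccos_ofReal (m : ℂ) (z : ℝ) :
    HasDerivAt (fun t : ℝ => Complex.cos (m * (t : ℂ))) (-(m * Complex.sin (m * (z : ℂ)))) z := by
  have h := (((hasDerivAt_id (z : ℂ)).const_mul m).ccos).comp_ofReal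
  simpa [mul_comm] using h

theorem hasDerivAt_csin_ofReal (m : ℂ) (z : ℝ) :
    HasDerivAt (fun t : ℝ => Complex.sin (m * (t : ℂ))) (m * Complex.cos (m * (z : ℂ))) z := by
  have h := (((hasDerivAt_id (z : ℂ)).const_mul m).csin).comp_ofReal
  simpa [mul_comm] using h

theorem pdx_cexp_mul (c k : ℂ) (h : ℝ → ℂ) :
    pdx (fun (x z : ℝ) => c * Complex.exp (k * (x : ℂ)) * h z) =
      fun (x z : ℝ) => (c * k) * Complex.exp (k * (x : ℂ)) * h z := by
  funext x z
  refine (((hasDerivAt_cexp_ofReal k x).const_mul c).mul_const (h z)).deriv.trans ?_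
  ring

theorem pdz_mul_ccos (c m : ℂ) (e : ℝ → ℂ) :
    pdz (fun (x z : ℝ) => c * e x * Complex.cos (m * (z : ℂ))) =
      fun (x z : ℝ) => (-(c * m)) * e x * Complex.sin (m * (z : ℂ)) := by
  funext x z
  refine ((hasDerivAt_ccos_ofReal m z).const_mul (c * e x)).deriv.trans ?_
  ring

theorem pdz_mul_csin (c m : ℂ) (e : ℝ → ℂ) :
    pdz (fun (x z : ℝ) => c * e x * Complex.sin (m * (z : ℂ))) =
      fun (x z : ℝ) => (c * m) * e x * Complex.cos (m * (z : ℂ)) := by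
  funext x z
  refine ((hasDerivAt_csin_ofReal m z).const_mul (c * e x)).deriv.trans ?_
  ring

theorem lap_cexp_mul_ccos (c k m : ℂ) (x z : ℝ) :
    lap (fun (x z : ℝ) => c * Complex.exp (k * (x : ℂ)) * Complex.cos (m * (z : ℂ))) x z =
      (k ^ 2 - m ^ 2) * (c * Complex.exp (k * (x : ℂ)) * Complex.cos (m * (z : ℂ))) := by
  simp only [lap, pdx_cexp_mul c k fun z : ℝ => Complex.cos (m * (z : ℂ)),
    pdx_cexp_mul (c * k) k fun z : ℝ => Complex.cos (m * (z : ℂ)),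
    pdz_mul_ccos c m fun x : ℝ => Complex.exp (k * (x : ℂ)),
    pdz_mul_csin (-(c * m)) m fun x : ℝ => Complex.exp (k * (x : ℂ))]
  ring

theorem lap_cexp_mul_csin (c k m : ℂ) (x z : ℝ) :
    lap (fun (x z : ℝ) => c * Complex.exp (k * (x : ℂ)) * Complex.sin (m * (z : ℂ))) x z =
      (k ^ 2 - m ^ 2) * (c * Complex.exp (k * (x : ℂ)) * Complex.sin (m * (z : ℂ))) := by
  simp only [lap, pdx_cexp_mul c k fun z : ℝ => Complex.sin (m * (z : ℂ)),
    pdx_cexp_mul (c * k) k fun z : ℝ => Complex.sin (m * (z : ℂ)),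
    pdz_mul_csin c m fun x : ℝ => Complex.exp (k * (x : ℂ)),
    pdz_mul_ccos (c * m) m fun x : ℝ => Complex.exp (k * (x : ℂ))]
  ring

theorem gamma2_pos {α : ℝ} {j : ℤ} (hα : 0 < α) (hj : j ≠ 0) (l : ℕ) : 0 < gamma2 α j l := by
  have hj' : (j : ℝ) ≠ 0 := Int.cast_ne_zero.mpr hj
  unfold gamma2
  positivity

/-- The root equation `fjlC = 0` cleared of the inverse of `gamma2`. -/
theorem factored_of_fjlC_eq_zero {σ τ lam η α : ℝ} {j : ℤ} {l : ℕ} {β : ℂ}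
    (hg : gamma2 α j l ≠ 0) (hroot : fjlC σ τ lam η α j l β = 0) :
    (gamma2 α j l : ℂ) * (β + σ * gamma2 α j l) * (β + gamma2 α j l) * (β + τ * gamma2 α j l) =
      σ * ((j : ℂ) * α) ^ 2 * (lam * (β + τ * gamma2 α j l) - η * (β + gamma2 α j l)) := by
  have hg' : (gamma2 α j l : ℂ) ≠ 0 := Complex.ofReal_ne_zero.mpr hg
  unfold fjlC at hroot
  push_cast at hroot
  generalize (gamma2 α j l : ℂ) = g at *
  field_simp at hroot
  linear_combination hroot

/-- the explicit fields built from a root β of f_{jl} solve the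
linearized double-diffusive eigenvalue problem pointwise, with the boundary
conditions at z = 0, 1. -/
theorem stmt9 (σ τ lam η α : ℝ) (j : ℤ) (l : ℕ) (β : ℂ)
    (hσ : 0 < σ) (hα : 0 < α) (hj : j ≠ 0) (hl : 1 ≤ l)
    (hroot : fjlC σ τ lam η α j l β = 0)
    (hβ1 : β ≠ -((gamma2 α j l : ℝ) : ℂ))
    (hβ2 : β ≠ -((τ * gamma2 α j l : ℝ) : ℂ))
    (u w T S p : ℝ → ℝ → ℂ)
    (hu : u = fun (x z : ℝ) => (Complex.I * (l : ℂ) * (π : ℂ) / ((j : ℂ) * (α : ℂ))) *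
      Complex.exp (Complex.I * (j : ℂ) * (α : ℂ) * (x : ℂ)) * Complex.cos ((l : ℂ) * (π : ℂ) * (z : ℂ)))
    (hw : w = fun (x z : ℝ) =>
      Complex.exp (Complex.I * (j : ℂ) * (α : ℂ) * (x : ℂ)) * Complex.sin ((l : ℂ) * (π : ℂ) * (z : ℂ)))
    (hT : T = fun (x z : ℝ) => (β + ((gamma2 α j l : ℝ) : ℂ))⁻¹ *
      Complex.exp (Complex.I * (j : ℂ) * (α : ℂ) * (x : ℂ)) * Complex.sin ((l : ℂ) * (π : ℂ) * (z : ℂ)))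
    (hS : S = fun (x z : ℝ) => (β + ((τ * gamma2 α j l : ℝ) : ℂ))⁻¹ *
      Complex.exp (Complex.I * (j : ℂ) * (α : ℂ) * (x : ℂ)) * Complex.sin ((l : ℂ) * (π : ℂ) * (z : ℂ)))
    (hp : p = fun (x z : ℝ) => -((l : ℂ) * (π : ℂ) * (β + ((σ * gamma2 α j l : ℝ) : ℂ)) /
        ((σ : ℂ) * (j : ℂ)^2 * (α : ℂ)^2)) *
      Complex.exp (Complex.I * (j : ℂ) * (α : ℂ) * (x : ℂ)) * Complex.cos ((l : ℂ) * (π : ℂ) * (z : ℂ))) :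
    (∀ x z : ℝ,
      (σ : ℂ) * (lap u x z - pdx p x z) = β * u x z ∧
      (σ : ℂ) * (lap w x z - pdz p x z) + (σ : ℂ) * (lam : ℂ) * T x z
        - (σ : ℂ) * (η : ℂ) * S x z = β * w x z ∧
      lap T x z + w x z = β * T x z ∧
      (τ : ℂ) * lap S x z + w x z = β * S x z ∧
      pdx u x z + pdz w x z = 0) ∧
    (∀ x : ℝ,
      pdz u x 0 = 0 ∧ pdz u x 1 = 0 ∧ w x 0 = 0 ∧ w x 1 = 0 ∧
      T x 0 = 0 ∧ T x 1 = 0 ∧ S x 0 = 0 ∧ S x 1 = 0) := by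
  have hg := gamma2_pos hα hj l
  have key := factored_of_fjlC_eq_zero hg.ne' hroot
  have hG : (gamma2 α j l : ℂ) = ((j : ℂ) * α) ^ 2 + ((l : ℂ) * π) ^ 2 := by
    unfold gamma2
    push_cast
    ring
  have hk : (j : ℂ) * α ≠ 0 :=
    mul_ne_zero (Int.cast_ne_zero.mpr hj) (Complex.ofReal_ne_zero.mpr hα.ne')
  have hs : (σ : ℂ) ≠ 0 := Complex.ofReal_ne_zero.mpr hσ.ne'
  push_cast at hβ2 hS hp
  have h1 : β + (gamma2 α j l : ℂ) ≠ 0 := fun h => hβ1 (eq_neg_of_add_eq_zero_left h)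
  have h2 : β + τ * (gamma2 α j l : ℂ) ≠ 0 := fun h => hβ2 (eq_neg_of_add_eq_zero_left h)
  have hsin : Complex.sin ((l : ℂ) * π) = 0 := Complex.sin_nat_mul_pi l
  have hw' : w = fun (x z : ℝ) => 1 * Complex.exp (Complex.I * (j : ℂ) * (α : ℂ) * (x : ℂ)) *
      Complex.sin ((l : ℂ) * (π : ℂ) * (z : ℂ)) := by
    simpa only [one_mul] using hw
  clear hw
  have hI : Complex.I * (j : ℂ) * (α : ℂ) = Complex.I * ((j : ℂ) * α) := mul_assoc _ _ _
  have hA : Complex.I * (l : ℂ) * (π : ℂ) = Complex.I * ((l : ℂ) * π) := mul_assoc _ _ _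
  have hB : (σ : ℂ) * (j : ℂ) ^ 2 * (α : ℂ) ^ 2 = σ * ((j : ℂ) * α) ^ 2 := by ring
  rw [hI] at hu hw' hT hS hp
  rw [hA] at hu
  rw [hB] at hp
  generalize (gamma2 α j l : ℂ) = g at *
  generalize (j : ℂ) * (α : ℂ) = k at *
  generalize (l : ℂ) * (π : ℂ) = m at *
  have hI2 := Complex.I_sq
  refine ⟨fun x z => ?_, fun x => ?_⟩
  · have hpx := congrFun (congrFun (pdx_cexp_mul (-(m * (β + σ * g) / (σ * k ^ 2)))
      (Complex.I * k) fun z : ℝ => Complex.cos (m * (z : ℂ))) x) z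
    have hpz := congrFun (congrFun (pdz_mul_ccos (-(m * (β + σ * g) / (σ * k ^ 2))) m
      fun x : ℝ => Complex.exp (Complex.I * k * (x : ℂ))) x) z
    have hux := congrFun (congrFun (pdx_cexp_mul (Complex.I * m / k)
      (Complex.I * k) fun z : ℝ => Complex.cos (m * (z : ℂ))) x) z
    have hwz := congrFun (congrFun (pdz_mul_csin 1 m
      fun x : ℝ => Complex.exp (Complex.I * k * (x : ℂ))) x) z
    have hkm : (Complex.I * k) ^ 2 - m ^ 2 = -g := by
      linear_combination k ^ 2 * hI2 + hG
    rw [← hp] at hpx hpz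
    rw [← hu] at hux
    rw [← hw'] at hwz
    have hul := lap_cexp_mul_ccos (Complex.I * m / k) (Complex.I * k) m x z
    have hwl := lap_cexp_mul_csin 1 (Complex.I * k) m x z
    have hTl := lap_cexp_mul_csin (β + g)⁻¹ (Complex.I * k) m x z
    have hSl := lap_cexp_mul_csin (β + τ * g)⁻¹ (Complex.I * k) m x z
    rw [← hu] at hul
    rw [← hw'] at hwl
    rw [← hT] at hTl
    rw [← hS] at hSl
    rw [hul, hwl, hTl, hSl, hpx, hpz, hux, hwz, hkm, hu, hw', hT, hS]
    clear hul hwl hTl hSl hpx hpz hux hwz hu hw' hT hS hp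
    beta_reduce
    generalize Complex.exp (Complex.I * k * (x : ℂ)) = e
    generalize Complex.sin (m * (z : ℂ)) = s
    generalize Complex.cos (m * (z : ℂ)) = c
    refine ⟨?_, ?_, ?_, ?_, ?_⟩
    · field_simp
      ring
    · have hm : m ^ 2 = g - k ^ 2 := by linear_combination -hG
      have hq : σ * (lam * (β + g)⁻¹ - η * (β + τ * g)⁻¹) = g * (β + σ * g) / k ^ 2 := by
        clear hβ1 hβ2 hkm
        generalize β + g = a at *
        generalize β + τ * g = b at *
        field_simp
        linear_combination -key
      have hr : m * (β + σ * g) / (σ * k ^ 2) * m * σ = g * (β + σ * g) / k ^ 2 - (β + σ * g) := by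
        field_simp
        rw [hm]
        ring
      linear_combination (e * s) * hq - (e * s) * hr
    · field_simp
      ring
    · field_simp
      ring
    · field_simp
      linear_combination (m * e * c) * hI2
  · have huz := pdz_mul_ccos (Complex.I * m / k) m
      fun x : ℝ => Complex.exp (Complex.I * k * (x : ℂ))
    rw [← hu] at huz
    simp [huz, hw', hT, hS, hsin]
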